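/- arXiv:1808.05412 — 2 statements merged into one kernel-verified Lean document; each statement's English description precedes it below -/
import Mathlib

section
/- Let f_Y : ℕ^m → ℝ be the Poisson-Gamma density f_Y(y) = Γ(a + Σ_{j=1}^m y_j) / (Γ(a) · ∏_{j=1}^m y_j!) · exp(Σ_{j=1}^m μ_j·y_j) / (b + Σ_{j=1}^m e^{μ_j})^{Σ_{j=1}^m y_j} · ( b / (b + Σ_{j=1}^m e^{μ_j}) )^a. Then for each index k ∈ {1,…,m}, the sum Σ_{y ∈ ℕ^m} y_k · f_Y(y) converges and equals (a/b)·e^{μ_k}; that is, the marginal expectation of Y_k in the Poisson-Gamma model is E(Y_k) = (a/b)·exp(μ_k). -/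
open Real Finset

lemma Real.Gamma_add_natCast_eq_ascPochhammer {a : ℝ} (ha : 0 < a) (n : ℕ) :
    Gamma (a + n) = (ascPochhammer ℝ n).eval a * Gamma a := by
  induction n with
  | zero => simp
  | succ n ih =>
    rw [Nat.cast_succ, ← add_assoc, Gamma_add_one (by positivity), ih, ascPochhammer_succ_eval]
    ring

lemma Real.choose_add_natCast_sub_one_eq_Gamma {a : ℝ} (ha : 0 < a) (n : ℕ) :
    Ring.choose (a + n - 1) n = Gamma (a + n) / (Gamma a * n.factorial) := by
  have h := Ring.factorial_nsmul_multichoose_eq_ascPochhammer a n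
  rw [Polynomial.ascPochhammer_smeval_eq_eval, nsmul_eq_mul, Ring.multichoose_eq] at h
  have := Gamma_pos_of_pos ha
  rw [Gamma_add_natCast_eq_ascPochhammer ha, ← h]
  field_simp

/-- The negative binomial series. -/
lemma Real.hasSum_Gamma_add_natCast {a S w : ℝ} (ha : 0 < a) (hw : 0 ≤ w) (hS : w < S) :
    HasSum (fun n : ℕ => Gamma (a + n) / S ^ (a + n) * (w ^ n / n.factorial))
      (Gamma a / (S - w) ^ a) := by
  have hS0 : 0 < S := hw.trans_lt hS
  have hlt : w / S < 1 := (div_lt_one hS0).2 hS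
  have h := (one_div_one_sub_rpow_hasFPowerSeriesOnBall_zero a).hasSum (y := w / S) (by
    simpa [enorm_eq_nnnorm, ← NNReal.coe_lt_coe, abs_of_nonneg hw, abs_of_pos hS0] using hlt)
  have hG := Gamma_pos_of_pos ha
  convert! h.mul_left (Gamma a / S ^ a) using 1
  · ext n
    simp only [FormalMultilinearSeries.ofScalars_apply_eq, smul_eq_mul,
      choose_add_natCast_sub_one_eq_Gamma ha, rpow_add hS0, rpow_natCast, div_pow]
    field_simp
  · rw [zero_add, one_sub_div hS0.ne', div_rpow (by linarith) hS0.le]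
    have : 0 < (S - w) ^ a := rpow_pos_of_pos (by linarith) _
    field_simp

lemma HasSum.prod_of_nonneg {β γ : Type*} {f : β × γ → ℝ} {g : β → ℝ} {s : ℝ} (hf : 0 ≤ f)
    (hg : ∀ x, HasSum (fun y => f (x, y)) (g x)) (hs : HasSum g s) : HasSum f s := by
  have hsum : Summable f := (summable_prod_of_nonneg hf).2
    ⟨fun x => (hg x).summable, by simpa only [(hg _).tsum_eq] using hs.summable⟩
  exact (hsum.hasSum.prod_fiberwise hg).unique hs ▸ hsum.hasSum

/-- The negative multinomial series. -/
lemma Real.hasSum_Gamma_add_sum {m : ℕ} {a S : ℝ} {w : Fin m → ℝ} (ha : 0 < a)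
    (hw : ∀ j, 0 ≤ w j) (hS : ∑ j, w j < S) :
    HasSum (fun y : Fin m → ℕ => Gamma (a + ∑ j, (y j : ℝ)) / S ^ (a + ∑ j, (y j : ℝ)) *
        ∏ j, (w j ^ y j / (y j).factorial))
      (Gamma a / (S - ∑ j, w j) ^ a) := by
  induction m generalizing a S with
  | zero => simp
  | succ m ih =>
    rw [Fin.sum_univ_succ] at hS ⊢
    have hw' : 0 ≤ ∑ j : Fin m, w j.succ := sum_nonneg fun j _ => hw _
    have hS0 : 0 < S := by linarith [hw 0]
    rw [← (Fin.consEquiv fun _ => ℕ).hasSum_iff]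
    refine HasSum.prod_of_nonneg
      (g := fun n : ℕ => Gamma (a + n) / (S - ∑ j : Fin m, w j.succ) ^ (a + n) *
        (w 0 ^ n / n.factorial)) ?_ ?_ ?_
    · intro y
      have := Gamma_nonneg_of_nonneg (s := a + ∑ j, ((Fin.consEquiv (fun _ => ℕ) y j : ℕ) : ℝ))
        (by positivity)
      have := prod_nonneg fun j (_ : j ∈ univ) => div_nonneg
        (pow_nonneg (hw j) (Fin.consEquiv (fun _ => ℕ) y j))
        (Nat.cast_nonneg' (α := ℝ) (Fin.consEquiv (fun _ => ℕ) y j).factorial)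
      simp only [Pi.zero_apply, Function.comp_apply]
      positivity
    · intro n
      convert! (ih (a := a + n) (S := S) (w := fun j => w j.succ) (by positivity)
        (fun j => hw _) (by linarith [hw 0])).mul_right (w 0 ^ n / n.factorial) using 1
      ext y
      simp only [Function.comp_apply, Fin.consEquiv_apply, Fin.sum_univ_succ, Fin.prod_univ_succ,
        Fin.cons_zero, Fin.cons_succ, add_assoc]
      ring
    · convert! hasSum_Gamma_add_natCast ha (hw 0) (S := S - ∑ j : Fin m, w j.succ)
        (by linarith) using 3
      ring

/-- The marginal expectation in the Poisson-Gamma model: the sum over all `y ∈ ℕ^m` of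
`y k` times the Poisson-Gamma density converges and equals `(a/b)·exp (μ k)`. -/
theorem poisson_gamma_marginal_expectation
    (a b : ℝ) (ha : 0 < a) (hb : 0 < b)
    (m : ℕ) (hm : 1 ≤ m) (μ : Fin m → ℝ) (k : Fin m) :
    HasSum
      (fun y : Fin m → ℕ =>
        (y k : ℝ) *
          (Real.Gamma (a + ∑ j, (y j : ℝ)) /
              (Real.Gamma a * ∏ j, (Nat.factorial (y j) : ℝ)) *
            (Real.exp (∑ j, μ j * (y j : ℝ)) /
              (b + ∑ j, Real.exp (μ j)) ^ (∑ j, y j)) *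
            (b / (b + ∑ j, Real.exp (μ j))) ^ a))
      (a / b * Real.exp (μ k)) := by
  have hS : 0 < b + ∑ j, exp (μ j) := by positivity
  have h := (hasSum_Gamma_add_sum (a := a + 1) (S := b + ∑ j, exp (μ j)) (w := fun j => exp (μ j))
    (by positivity) (fun j => (exp_pos _).le) (by linarith)).mul_left (b ^ a * exp (μ k) / Gamma a)
  have hG := Gamma_pos_of_pos ha
  rw [← (add_left_injective (Pi.single k 1 : Fin m → ℕ)).hasSum_iff]
  · convert! h using 1
    · ext y
      have hsum : ∑ j, (y + (Pi.single k 1 : Fin m → ℕ)) j = ∑ j, y j + 1 := by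
        simp [sum_add_distrib]
      have hsum' : ∑ j, (((y + (Pi.single k 1 : Fin m → ℕ)) j : ℕ) : ℝ) = ∑ j, (y j : ℝ) + 1 :=
        mod_cast hsum
      have hexp : ∑ j, μ j * (((y + (Pi.single k 1 : Fin m → ℕ)) j : ℕ) : ℝ) =
          ∑ j, μ j * (y j : ℝ) + μ k := by
        simp [mul_add, sum_add_distrib, Pi.single_apply]
      have hfac : ∏ j, (((y + (Pi.single k 1 : Fin m → ℕ)) j).factorial : ℝ) =
          (y k + 1) * ∏ j, ((y j).factorial : ℝ) := by
        rw [← mul_prod_erase _ _ (mem_univ k), ← mul_prod_erase _ (fun j => ((y j).factorial : ℝ))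
          (mem_univ k), prod_congr rfl fun j hj => by
            rw [Pi.add_apply, Pi.single_eq_of_ne (ne_of_mem_erase hj), add_zero]]
        simp [Nat.factorial_succ, mul_assoc]
      have hprod : ∏ j, exp (μ j) ^ y j = exp (∑ j, μ j * (y j : ℝ)) := by
        rw [exp_sum]
        exact prod_congr rfl fun j _ => by rw [mul_comm, exp_nat_mul]
      have hpow : (b + ∑ j, exp (μ j)) ^ (a + 1 + ∑ j, (y j : ℝ)) =
          (b + ∑ j, exp (μ j)) ^ a * (b + ∑ j, exp (μ j)) ^ (∑ j, y j + 1) := by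
        rw [← rpow_natCast, ← rpow_add hS]
        congr 1
        push_cast
        ring
      have hk : (((y + (Pi.single k 1 : Fin m → ℕ)) k : ℕ) : ℝ) = y k + 1 := by simp
      have hf : 0 < ∏ j, ((y j).factorial : ℝ) := prod_pos fun j _ => mod_cast (y j).factorial_pos
      have hSa : 0 < (b + ∑ j, exp (μ j)) ^ a := rpow_pos_of_pos hS a
      simp only [Function.comp_apply]
      rw [hk, hsum, hsum', hexp, hfac, exp_add, div_rpow hb.le hS.le, hpow, prod_div_distrib,
        hprod, show a + (∑ j, (y j : ℝ) + 1) = a + 1 + ∑ j, (y j : ℝ) by ring]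
      field_simp
    · rw [add_sub_cancel_right, Gamma_add_one ha.ne', rpow_add_one hb.ne']
      have : 0 < b ^ a := rpow_pos_of_pos hb a
      field_simp
  · intro y hy
    have hk : y k = 0 := by
      by_contra hk
      refine hy ⟨y - Pi.single k 1, ?_⟩
      ext j
      obtain rfl | hj := eq_or_ne j k
      · simp
        omega
      · simp [Pi.single_eq_of_ne hj]
    simp [hk]
end

section
/- Let X = [u₁,v₁] × … × [u_{p−1},v_{p−1}] ⊂ ℝ^{p−1} with u_i < v_i, let β = (β₀,β₁,…,β_{p−1}) ∈ ℝ^p with β_i ≠ 0 for i = 1,…,p−1, and let d = (d₁,…,d_{p−1}) with d_i = v_i if β_i > 0 and d_i = u_i if β_i < 0. Let z* ∈ (0,∞) be the unique solution of the equation 0 = m·( (p−1)·w₁*(z)·e^{f(d)ᵀβ−z} + w_p*(z)·e^{f(d)ᵀβ} )·( z·(p−1)·w₁*(z) − 2 ) + b·( z·p·w₁*(z) − 2 ), where w_p*(z) = 2 / ( p + √( (p−2)² + 4·(p−1)·(1 + (m/b)·e^{f(d)ᵀβ})/(1 + (m/b)·e^{f(d)ᵀβ−z}) ) ) and w₁*(z)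 = (1 − w_p*(z))/(p−1). Assume z* ≤ min_{i=1,…,p−1} |β_i|·(v_i − u_i). Let ξ* be the design with support points d − (z*/β_i)·e_i for i = 1,…,p−1 (each with weight w₁*(z*)) and d (with weight w_p*(z*)), where e_i is the i-th standard unit vector of ℝ^{p−1}. Then ξ* is D-optimal for the Poisson-Gamma model on X: for every design ξ on X, i.e. every finite family of points y₁,…,y_l ∈ X with weights q₁,…,q_l ≥ 0 summing to 1, one has det(M(ξ;β)) ≤ det(M(ξ*;β)). -/
open Matrix Real Finset

/-- The regression vector `f(x) = (1, xᵀ)ᵀ ∈ ℝ^p` of multiple regression. -/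
noncomputable def fvec (p : ℕ) (x : Fin (p - 1) → ℝ) : Fin p → ℝ :=
  fun j => if h : (j : ℕ) = 0 then 1 else x ⟨(j : ℕ) - 1, by have := j.isLt; omega⟩

/-- The first standard unit vector `e₁ ∈ ℝ^p`. -/
noncomputable def e1v (p : ℕ) : Fin p → ℝ :=
  fun i => if (i : ℕ) = 0 then 1 else 0

/-- The information matrix of the Poisson model for the design with support points
`x j` and weights `w j`. -/
noncomputable def infoMPo {p l : ℕ} (β : Fin p → ℝ)
    (x : Fin l → Fin (p - 1) → ℝ) (w : Fin l → ℝ) : Matrix (Fin p) (Fin p) ℝ :=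
  ∑ j, (w j * Real.exp (fvec p (x j) ⬝ᵥ β)) •
    Matrix.vecMulVec (fvec p (x j)) (fvec p (x j))

/-- The information matrix of the Poisson-Gamma model for the design with support points
`x j` and weights `w j`. -/
noncomputable def infoM (a b m : ℝ) {p l : ℕ} (β : Fin p → ℝ)
    (x : Fin l → Fin (p - 1) → ℝ) (w : Fin l → ℝ) : Matrix (Fin p) (Fin p) ℝ :=
  (a / b) • (infoMPo β x w -
    (e1v p ⬝ᵥ (infoMPo β x w *ᵥ e1v p) + b / m)⁻¹ •
      (infoMPo β x w * Matrix.vecMulVec (e1v p) (e1v p) * infoMPo β x w))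

section DetInequality

variable {ι : Type*} [Fintype ι]

/-- The Schur-type correction `M - M e eᵀ M / (eᵀ M e + τ)`. -/
noncomputable def corrected (τ : ℝ) (e : ι → ℝ) (M : Matrix ι ι ℝ) : Matrix ι ι ℝ :=
  M - (e ⬝ᵥ (M *ᵥ e) + τ)⁻¹ • (M * Matrix.vecMulVec e e * M)

lemma corrected_conj (τ : ℝ) (e : ι → ℝ) (G M : Matrix ι ι ℝ) :
    corrected τ e (G * M * Gᵀ) = G * corrected τ (Gᵀ *ᵥ e) M * Gᵀ := by
  have h1 : e ⬝ᵥ ((G * M * Gᵀ) *ᵥ e) = (Gᵀ *ᵥ e) ⬝ᵥ (M *ᵥ (Gᵀ *ᵥ e)) := by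
    rw [Matrix.mul_assoc, ← Matrix.mulVec_mulVec, Matrix.dotProduct_mulVec,
      ← Matrix.mulVec_transpose, Matrix.mulVec_mulVec]
  have h2 : Matrix.vecMulVec (Gᵀ *ᵥ e) (Gᵀ *ᵥ e) = Gᵀ * Matrix.vecMulVec e e * G := by
    rw [Matrix.mul_vecMulVec, Matrix.vecMulVec_mul, ← Matrix.mulVec_transpose]
  rw [corrected, corrected, h1, h2]
  simp only [ Matrix.mul_sub, Matrix.sub_mul, Matrix.mul_smul,
    Matrix.smul_mul, Matrix.mul_assoc]

lemma corrected_eq {M : Matrix ι ι ℝ} (hM : M.IsSymm) (τ : ℝ) (e : ι → ℝ) :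
    corrected τ e M =
      M - (e ⬝ᵥ (M *ᵥ e) + τ)⁻¹ • Matrix.vecMulVec (M *ᵥ e) (M *ᵥ e) := by
  rw [corrected, Matrix.mul_vecMulVec, Matrix.vecMulVec_mul, ← Matrix.mulVec_transpose, hM.eq]

variable [DecidableEq ι]

lemma det_le_one_of_trace_le_card {A : Matrix ι ι ℝ} (hA : A.PosSemidef)
    (htr : A.trace ≤ Fintype.card ι) : A.det ≤ 1 := by
  have hdet := hA.isHermitian.det_eq_prod_eigenvalues
  have htrace := hA.isHermitian.trace_eq_sum_eigenvalues
  simp only [RCLike.ofReal_real_eq_id, id] at hdet htrace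
  rw [hdet]
  calc ∏ i, hA.isHermitian.eigenvalues i
      ≤ ∏ i, Real.exp (hA.isHermitian.eigenvalues i - 1) :=
        Finset.prod_le_prod (fun i _ => hA.eigenvalues_nonneg i)
          (fun i _ => by linarith [Real.add_one_le_exp (hA.isHermitian.eigenvalues i - 1)])
    _ = Real.exp (A.trace - Fintype.card ι) := by
        rw [← Real.exp_sum, Finset.sum_sub_distrib, ← htrace]
        simp
    _ ≤ 1 := Real.exp_le_one_iff.2 (by linarith)

open scoped MatrixOrder in
lemma det_mul_det_le_one_of_trace_mul_le_card {P A : Matrix ι ι ℝ} (hP : P.PosSemidef)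
    (hA : A.PosSemidef) (htr : (P * A).trace ≤ Fintype.card ι) : P.det * A.det ≤ 1 := by
  obtain ⟨R, rfl⟩ := CStarAlgebra.nonneg_iff_eq_star_mul_self.mp hP.nonneg
  rw [Matrix.star_eq_conjTranspose] at *
  have h := det_le_one_of_trace_le_card (hA.mul_mul_conjTranspose_same R) (by
    rwa [Matrix.trace_mul_comm, ← Matrix.mul_assoc])
  calc (Rᴴ * R).det * A.det = (R * A * Rᴴ).det := by simp only [Matrix.det_mul]; ring
    _ ≤ 1 := h

lemma corrected_posSemidef {M : Matrix ι ι ℝ} (hM : M.PosSemidef) {τ : ℝ} (hτ : 0 < τ)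
    (e : ι → ℝ) : (corrected τ e M).PosSemidef := by
  have hs : Mᵀ = M := by simpa [Matrix.IsSymm] using hM.isHermitian
  have hc : 0 ≤ e ⬝ᵥ (M *ᵥ e) := by simpa using hM.dotProduct_mulVec_nonneg e
  set c := e ⬝ᵥ (M *ᵥ e) with hcdef
  set g := (c + τ)⁻¹ with hg
  have hgc : g * (c + τ) = 1 := inv_mul_cancel₀ (by positivity)
  have hrank : (Matrix.vecMulVec (M *ᵥ e) (M *ᵥ e)).PosSemidef := by
    simpa using Matrix.posSemidef_vecMulVec_self_star (M *ᵥ e)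
  have key : corrected τ e M =
      (1 - g • Matrix.vecMulVec (M *ᵥ e) e) * M * (1 - g • Matrix.vecMulVec (M *ᵥ e) e)ᴴ
        + (g ^ 2 * τ) • Matrix.vecMulVec (M *ᵥ e) (M *ᵥ e) := by
    rw [corrected_eq hs, ← hcdef, ← hg]
    have h1 : Matrix.vecMulVec (M *ᵥ e) e * M = Matrix.vecMulVec (M *ᵥ e) (M *ᵥ e) := by
      rw [Matrix.vecMulVec_mul, ← Matrix.mulVec_transpose, hs]
    have h2 : M * Matrix.vecMulVec e (M *ᵥ e) = Matrix.vecMulVec (M *ᵥ e) (M *ᵥ e) := by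
      rw [Matrix.mul_vecMulVec]
    have h3 : Matrix.vecMulVec (M *ᵥ e) (M *ᵥ e) * Matrix.vecMulVec e (M *ᵥ e)
        = c • Matrix.vecMulVec (M *ᵥ e) (M *ᵥ e) := by
      rw [Matrix.vecMulVec_mul_vecMulVec, dotProduct_comm, ← hcdef, Matrix.vecMulVec_smul]
    have h4 : (1 - g • Matrix.vecMulVec (M *ᵥ e) e)ᴴ
        = 1 - g • Matrix.vecMulVec e (M *ᵥ e) := by
      simp [Matrix.conjTranspose_eq_transpose_of_trivial, Matrix.transpose_vecMulVec]
    rw [h4]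
    simp only [Matrix.sub_mul, Matrix.mul_sub, Matrix.one_mul, Matrix.mul_one, Matrix.smul_mul,
      Matrix.mul_smul, h1, h2, h3]
    rw [← sub_eq_zero]
    have : g - 2 * g + g ^ 2 * (c + τ) = 0 := by linear_combination g * hgc
    calc _ = -(g - 2 * g + g ^ 2 * (c + τ)) • Matrix.vecMulVec (M *ᵥ e) (M *ᵥ e) := by module
      _ = 0 := by rw [this]; simp
  rw [key]
  exact (hM.mul_mul_conjTranspose_same _).add (hrank.smul (by positivity))

lemma det_corrected_le_of_trace_le {M : Matrix ι ι ℝ} (hM : M.PosSemidef) {D : ι → ℝ}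
    (hD : ∀ i, 0 < D i) {τ : ℝ} (hτ : 0 < τ)
    (htr : ∑ i, M i i / D i ≤
      Fintype.card ι - 1 + (τ + ∑ i, ∑ j, M i j) / (τ + ∑ i, D i)) :
    (corrected τ 1 M).det ≤ (corrected τ 1 (Matrix.diagonal D)).det := by
  have hs : Mᵀ = M := by simpa [Matrix.IsSymm] using hM.isHermitian
  set c := ∑ i, ∑ j, M i j with hcdef
  set C := ∑ i, D i with hCdef
  have hce : (1 : ι → ℝ) ⬝ᵥ (M *ᵥ 1) = c := by
    simp [dotProduct, Matrix.mulVec, hcdef]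
  have hCe : (1 : ι → ℝ) ⬝ᵥ (Matrix.diagonal D *ᵥ 1) = C := by
    simp [dotProduct, Matrix.mulVec_diagonal, hCdef]
  have hc : 0 ≤ c := by
    rw [← hce]; simpa using hM.dotProduct_mulVec_nonneg (1 : ι → ℝ)
  have hC : 0 ≤ C := Finset.sum_nonneg fun i _ => (hD i).le
  set h : ι → ℝ := M *ᵥ 1 with hh
  have hsum : ∑ i, h i = c := by simp [hh, Matrix.mulVec, dotProduct, hcdef]
  set P : Matrix ι ι ℝ := Matrix.diagonal (fun i => (D i)⁻¹) + τ⁻¹ • Matrix.vecMulVec 1 1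
    with hPdef
  have hPd : P.PosDef := by
    refine (Matrix.PosDef.diagonal fun i => inv_pos.2 (hD i)).add_posSemidef ?_
    refine Matrix.PosSemidef.smul ?_ (by positivity)
    simpa using Matrix.posSemidef_vecMulVec_self_star (1 : ι → ℝ)
  have hinv : P * corrected τ 1 (Matrix.diagonal D) = 1 := by
    rw [corrected_eq (Matrix.isSymm_diagonal D), hCe]
    ext i j
    have hDi := (hD i).ne'
    simp only [hPdef, Matrix.mul_apply, Matrix.add_apply, Matrix.sub_apply, Matrix.smul_apply,
      Matrix.vecMulVec_apply, Matrix.mulVec_diagonal, Pi.one_apply, smul_eq_mul, mul_one,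
      Matrix.diagonal_apply, Matrix.one_apply, add_mul, mul_sub, Finset.sum_add_distrib,
      Finset.sum_sub_distrib, ite_mul, mul_ite, zero_mul, mul_zero, Finset.sum_ite_eq,
      Finset.sum_ite_eq', Finset.mem_univ, if_true]
    have : ∑ x, τ⁻¹ * ((C + τ)⁻¹ * (D x * D j)) = τ⁻¹ * ((C + τ)⁻¹ * (C * D j)) := by
      rw [hCdef, Finset.sum_mul, Finset.mul_sum, Finset.mul_sum]
    rw [this]
    have hCτ : C + τ ≠ 0 := by positivity
    by_cases hij : i = j
    · subst hij; simp only [if_true]; field_simp; ring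
    · simp only [hij, if_false]; field_simp; ring
  have htrace : (P * corrected τ 1 M).trace =
      ∑ i, M i i / D i - (c + τ)⁻¹ * ∑ i, h i ^ 2 / D i + c / (c + τ) := by
    rw [corrected_eq hs, hce, ← hh]
    have hcτ : c + τ ≠ 0 := by positivity
    have e1 : (Matrix.diagonal (fun i => (D i)⁻¹) *
        (M - (c + τ)⁻¹ • Matrix.vecMulVec h h)).trace =
        ∑ i, M i i / D i - (c + τ)⁻¹ * ∑ i, h i ^ 2 / D i := by
      simp only [Matrix.trace, Matrix.diag_apply, Matrix.diagonal_mul, Matrix.sub_apply,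
        Matrix.smul_apply, Matrix.vecMulVec_apply, smul_eq_mul]
      rw [Finset.mul_sum, ← Finset.sum_sub_distrib]
      refine Finset.sum_congr rfl fun i _ => ?_
      ring
    have e2 : (Matrix.vecMulVec (1 : ι → ℝ) 1 *
        (M - (c + τ)⁻¹ • Matrix.vecMulVec h h)).trace = c - (c + τ)⁻¹ * c ^ 2 := by
      rw [Matrix.vecMulVec_mul, Matrix.trace_vecMulVec, dotProduct_comm,
        ← Matrix.dotProduct_mulVec, Matrix.sub_mulVec, dotProduct_sub, ← hh,
        Matrix.smul_mulVec, Matrix.vecMulVec_mulVec]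
      have hh1 : h ⬝ᵥ (1 : ι → ℝ) = c := by rw [dotProduct_comm, hce]
      simp only [hce, hh1, dotProduct_smul, smul_eq_mul, op_smul_eq_smul]
      ring
    rw [hPdef, Matrix.add_mul, Matrix.trace_add, e1, Matrix.smul_mul, Matrix.trace_smul, e2]
    simp only [smul_eq_mul]
    field_simp
    ring
  set r := (τ + c) / (τ + C) with hr
  have hsq : 2 * r * c - r ^ 2 * C ≤ ∑ i, h i ^ 2 / D i := by
    rw [← hsum, hCdef, Finset.mul_sum, Finset.mul_sum, ← Finset.sum_sub_distrib]
    refine Finset.sum_le_sum fun i _ => ?_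
    rw [le_div_iff₀ (hD i)]
    nlinarith [sq_nonneg (h i - r * D i)]
  have hle : (P * corrected τ 1 M).trace ≤ Fintype.card ι := by
    rw [htrace]
    have hcτ : 0 < c + τ := by positivity
    have hCτ : 0 < τ + C := by positivity
    have hrC : r * (τ + C) = τ + c := div_mul_cancel₀ _ hCτ.ne'
    have h1 : (c + τ)⁻¹ * (2 * r * c - r ^ 2 * C) ≤ (c + τ)⁻¹ * ∑ i, h i ^ 2 / D i :=
      mul_le_mul_of_nonneg_left hsq (by positivity)
    have h2 : r - 1 - (c + τ)⁻¹ * (2 * r * c - r ^ 2 * C) + c / (c + τ)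
        = -(τ * (1 - r) ^ 2) / (c + τ) := by
      field_simp
      linear_combination r * hrC
    have h3 : -(τ * (1 - r) ^ 2) / (c + τ) ≤ 0 :=
      div_nonpos_of_nonpos_of_nonneg (by have := sq_nonneg (1 - r); nlinarith) hcτ.le
    linarith
  have hfin := det_mul_det_le_one_of_trace_mul_le_card hPd.posSemidef
    (corrected_posSemidef hM hτ 1) hle
  have hone : P.det * (corrected τ 1 (Matrix.diagonal D)).det = 1 := by
    rw [← Matrix.det_mul, hinv, Matrix.det_one]
  rw [← hone] at hfin
  exact le_of_mul_le_mul_left hfin hPd.det_pos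

end DetInequality

/-- A quadratic interpolating `K * exp` at `0` and, to second order, at `z > 0` lies below
`K * exp` on the nonnegative half-line. -/
lemma quadratic_le_exp_of_hermite {K a b c z : ℝ} (hK : 0 ≤ K) (hz : 0 < z) (h0 : a = K)
    (h1 : a + b * z + c * z ^ 2 = K * Real.exp z) (h2 : b + 2 * c * z = K * Real.exp z)
    {s : ℝ} (hs : 0 ≤ s) : a + b * s + c * s ^ 2 ≤ K * Real.exp s := by
  set h : ℝ → ℝ := fun s => K * Real.exp s - (a + b * s + c * s ^ 2) with hh
  set g : ℝ → ℝ := fun s => K * Real.exp s - (b + 2 * c * s) with hg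
  have hder : ∀ x, HasDerivAt h (g x) x := by
    intro x
    have h3 : HasDerivAt (fun s : ℝ => a + b * s + c * s ^ 2) (b * 1 + c * (2 * x)) x := by
      have := ((hasDerivAt_id x).const_mul b |>.const_add a).add
        ((hasDerivAt_pow 2 x).const_mul c)
      convert! this using 1
      norm_num
    have := ((Real.hasDerivAt_exp x).const_mul K).sub h3
    convert! this using 1
    simp only [hg]; ring
  have hcont : Continuous h := continuous_iff_continuousAt.2 fun x => (hder x).continuousAt
  have hh0 : h 0 = 0 := by simp [hh, h0]
  have hhz : h z = 0 := by simp [hh, h1]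
  have hgz : g z = 0 := by simp [hg, h2]
  obtain ⟨t, ⟨ht0, htz⟩, hgt⟩ := exists_hasDerivAt_eq_zero hz hcont.continuousOn
    (hh0.trans hhz.symm) (fun x _ => hder x)
  have hconv : ∀ x y w, x < y → y < w → g y * (w - x) ≤ (w - y) * g x + (y - x) * g w := by
    intro x y w hxy hyw
    have hpos : 0 < w - x := by linarith
    have := convexOn_exp.2 (Set.mem_univ x) (Set.mem_univ w)
      (div_nonneg (by linarith : 0 ≤ w - y) hpos.le)
      (div_nonneg (by linarith : 0 ≤ y - x) hpos.le) (by field_simp; ring)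
    simp only [smul_eq_mul] at this
    have hy : (w - y) / (w - x) * x + (y - x) / (w - x) * w = y := by field_simp; ring
    rw [hy] at this
    have h5 : Real.exp y * (w - x) ≤ (w - y) * Real.exp x + (y - x) * Real.exp w := by
      calc _ ≤ _ := mul_le_mul_of_nonneg_right this hpos.le
        _ = _ := by field_simp
    simp only [hg]
    nlinarith [mul_le_mul_of_nonneg_left h5 hK]
  suffices 0 ≤ h s by simp only [hh] at this; linarith
  rcases le_or_gt s t with hst | hst
  · have hmono : MonotoneOn h (Set.Icc 0 t) := by
      refine monotoneOn_of_hasDerivWithinAt_nonneg (convex_Icc 0 t) hcont.continuousOn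
        (fun x _ => (hder x).hasDerivWithinAt) ?_
      intro x hx
      rw [interior_Icc] at hx
      have := hconv x t z hx.2 htz
      rw [hgt, hgz] at this
      have h6 : 0 < z - t := by linarith
      by_contra! hneg
      nlinarith
    rw [← hh0]
    exact hmono ⟨le_rfl, ht0.le⟩ ⟨hs, hst⟩ hs
  rcases le_or_gt s z with hsz | hsz
  · have hanti : AntitoneOn h (Set.Icc t z) := by
      refine antitoneOn_of_hasDerivWithinAt_nonpos (convex_Icc t z) hcont.continuousOn
        (fun x _ => (hder x).hasDerivWithinAt) ?_
      intro x hx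
      rw [interior_Icc] at hx
      have := hconv t x z hx.1 hx.2
      rw [hgt, hgz] at this
      by_contra! hneg
      nlinarith
    rw [← hhz]
    exact hanti ⟨hst.le, hsz⟩ ⟨htz.le, le_rfl⟩ hsz
  · have hmono : MonotoneOn h (Set.Ici z) := by
      refine monotoneOn_of_hasDerivWithinAt_nonneg (convex_Ici z) hcont.continuousOn
        (fun x _ => (hder x).hasDerivWithinAt) ?_
      intro x hx
      rw [interior_Ici] at hx
      have := hconv t z x htz hx
      rw [hgt, hgz] at this
      have h6 : 0 < z - t := by linarith
      by_contra! hneg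
      nlinarith
    rw [← hhz]
    exact hmono Set.self_mem_Ici hsz.le hsz.le

/-- The weight `wp` in closed form is the root of a quadratic equation balancing the weights. -/
lemma weight_balance {n A B wp w1 : ℝ} (hn : 1 ≤ n) (hB : 0 < B) (hAB : B < A)
    (hwp : wp = 2 / (n + 1 + Real.sqrt ((n - 1) ^ 2 + 4 * n * (A / B))))
    (hw1 : w1 = (1 - wp) / n) :
    0 < wp ∧ 0 < w1 ∧ wp * (n * w1 * B + wp * A) = w1 * B := by
  set R := Real.sqrt ((n - 1) ^ 2 + 4 * n * (A / B)) with hR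
  have hAB' : 1 < A / B := (one_lt_div hB).2 hAB
  have hR2 : R ^ 2 = (n - 1) ^ 2 + 4 * n * (A / B) := by
    rw [hR, Real.sq_sqrt]
    have := sq_nonneg (n - 1)
    nlinarith
  have hRlt : n - 1 < R := Real.lt_sqrt_of_sq_lt (by nlinarith)
  have hden : 0 < n + 1 + R := by linarith
  have hden2 : 2 < n + 1 + R := by linarith
  have hwpp : 0 < wp := by rw [hwp]; positivity
  have hwplt : wp < 1 := by rw [hwp, div_lt_one hden]; exact hden2
  have hn0 : 0 < n := by linarith
  have hw1p : 0 < w1 := by rw [hw1]; exact div_pos (by linarith) hn0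
  refine ⟨hwpp, hw1p, ?_⟩
  have hnw : n * w1 = 1 - wp := by rw [hw1]; field_simp
  have hwR : wp * (n + 1 + R) = 2 := by rw [hwp]; field_simp
  have hwR' : wp * R = 2 - wp * (n + 1) := by linarith
  have hsq : wp ^ 2 * ((n - 1) ^ 2 + 4 * n * (A / B)) = (2 - wp * (n + 1)) ^ 2 := by
    rw [← hR2, ← hwR']; ring
  have hABB : A / B * B = A := div_mul_cancel₀ _ hB.ne'
  have hsq' : n * wp ^ 2 * (A / B) = 1 - wp * (n + 1) + n * wp ^ 2 := by linarith
  have hsq2 : n * wp ^ 2 * A = (1 - wp * (n + 1) + n * wp ^ 2) * B := by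
    rw [← hsq', mul_assoc (n * wp ^ 2), hABB]
  refine mul_left_cancel₀ hn0.ne' ?_
  linear_combination (wp * n * B - B) * hnw + hsq2

/-- The sensitivity inequality of the equivalence theorem. -/
lemma sensitivity_le {n : ℕ} {τ E z wp w1 : ℝ} (hτ : 0 < τ) (hE : 0 < E) (hz : 0 < z)
    (hwp : 0 < wp) (hw1 : 0 < w1) (hsum : n * w1 + wp = 1) {T : ℝ}
    (hT : T = τ + E * (n * w1 * Real.exp (-z) + wp))
    (hbal : wp * T = w1 * (τ + E * Real.exp (-z)))
    (hopt : 2 * T = z * w1 * (n * T + τ))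
    {s : Fin n → ℝ} (hs : ∀ i, 0 ≤ s i) :
    E * Real.exp (-∑ i, s i) * (∑ i, (s i / z) ^ 2 / (w1 * (E * Real.exp (-z)))
        + (1 - ∑ i, s i / z) ^ 2 / (wp * E))
      ≤ n + τ / T + E * Real.exp (-∑ i, s i) / T := by
  have hTpos : 0 < T := by rw [hT]; positivity
  have hT' : T = n * w1 * (τ + E * Real.exp (-z)) + wp * (τ + E) := by
    rw [hT]; linear_combination -τ * hsum
  set S := ∑ i, s i with hS
  have hS0 : 0 ≤ S := Finset.sum_nonneg fun i _ => hs i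
  set K := n + τ / T with hK
  have hKT : K * T = n * T + τ := by rw [hK]; field_simp
  have hez : Real.exp z * Real.exp (-z) = 1 := by rw [← Real.exp_add]; simp
  have h0 : 1 / wp - E / T = K := by
    refine mul_right_cancel₀ (mul_pos hwp hTpos).ne' ?_
    calc (1 / wp - E / T) * (wp * T) = T - E * wp := by field_simp
      _ = K * (wp * T) := by linear_combination (-wp) * hKT - n * hbal + hT'
  have h1 : 1 / w1 - E * Real.exp (-z) / T = K := by
    refine mul_right_cancel₀ (mul_pos hw1 hTpos).ne' ?_
    calc (1 / w1 - E * Real.exp (-z) / T) * (w1 * T) = T - E * Real.exp (-z) * w1 := by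
          field_simp
      _ = K * (w1 * T) := by linear_combination (-w1) * hKT + hbal - T * hsum
  have h2 : 2 / (z * w1) = K := by
    rw [div_eq_iff (by positivity)]
    refine mul_right_cancel₀ hTpos.ne' ?_
    linear_combination hopt - z * w1 * hKT
  have hKpos : 0 ≤ K := by positivity
  have hquad := quadratic_le_exp_of_hermite (a := 1 / wp - E / T) (b := -2 / (z * wp))
    (c := Real.exp z / (z ^ 2 * w1) + 1 / (z ^ 2 * wp)) hKpos hz h0
    (by
      rw [← h1, sub_mul, div_mul_eq_mul_div _ T, mul_assoc E, mul_comm (Real.exp (-z)), hez]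
      field_simp
      ring)
    (by rw [← h2]; field_simp; ring) hS0
  have hsq : ∑ i, s i ^ 2 ≤ S ^ 2 := by
    rw [hS]; exact Finset.sum_sq_le_sq_sum_of_nonneg fun i _ => hs i
  have e1 : ∑ i, (s i / z) ^ 2 / (w1 * (E * Real.exp (-z)))
      = (∑ i, s i ^ 2) * (Real.exp z / (z ^ 2 * w1)) / E := by
    rw [Finset.sum_mul, Finset.sum_div]
    refine Finset.sum_congr rfl fun i _ => ?_
    rw [Real.exp_neg]
    field_simp
  have e2 : ∑ i, s i / z = S / z := by rw [← Finset.sum_div]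
  have hSexp : Real.exp S * Real.exp (-S) = 1 := by rw [← Real.exp_add]; simp
  have hmain : (∑ i, s i ^ 2) * (Real.exp z / (z ^ 2 * w1)) + (1 - S / z) ^ 2 / wp - E / T
      ≤ K * Real.exp S := by
    have h3 : (∑ i, s i ^ 2) * (Real.exp z / (z ^ 2 * w1))
        ≤ S ^ 2 * (Real.exp z / (z ^ 2 * w1)) :=
      mul_le_mul_of_nonneg_right hsq (by positivity)
    have h4 : (1 - S / z) ^ 2 / wp = 1 / wp + -2 / (z * wp) * S + 1 / (z ^ 2 * wp) * S ^ 2 := by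
      field_simp
      ring
    rw [h4]
    linarith
  rw [e1, e2]
  have h5 := mul_le_mul_of_nonneg_right hmain (Real.exp_pos (-S)).le
  rw [mul_assoc K, hSexp, mul_one] at h5
  calc _ = ((∑ i, s i ^ 2) * (Real.exp z / (z ^ 2 * w1)) + (1 - S / z) ^ 2 / wp - E / T)
        * Real.exp (-S) + E * Real.exp (-S) / T := by field_simp; ring
    _ ≤ _ := by linarith

lemma fvec_zero {n : ℕ} (x : Fin n → ℝ) : fvec (n + 1) x 0 = 1 := rfl

lemma fvec_succ {n : ℕ} (x : Fin n → ℝ) (i : Fin n) : fvec (n + 1) x i.succ = x i := by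
  simp [fvec]

lemma fvec_dotProduct {n : ℕ} (x : Fin n → ℝ) (β : Fin (n + 1) → ℝ) :
    fvec (n + 1) x ⬝ᵥ β = β 0 + ∑ i, x i * β i.succ := by
  simp [dotProduct, Fin.sum_univ_succ, fvec_zero, fvec_succ]

/-- Barycentric coordinates of the linear predictor with respect to the candidate support
points, as a function of the slacks `s i = β i * (d i - x i)`. -/
noncomputable def bary {n : ℕ} (z : ℝ) (s : Fin n → ℝ) : Fin (n + 1) → ℝ :=
  Fin.snoc (fun i => s i / z) (1 - ∑ i, s i / z)

lemma sum_bary {n : ℕ} (z : ℝ) (s : Fin n → ℝ) : ∑ i, bary z s i = 1 := by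
  simp [bary, Fin.sum_univ_castSucc]

lemma fvec_eq_sum_bary {n : ℕ} {z : ℝ} (hz : 0 < z) {β : Fin (n + 1) → ℝ}
    (hβ : ∀ i : Fin n, β i.succ ≠ 0) {d : Fin n → ℝ} {xs : Fin (n + 1) → Fin n → ℝ}
    (hxs : ∀ i : Fin n, xs i.castSucc = fun k => d k - if k = i then z / β i.succ else 0)
    (hxl : xs (Fin.last n) = d) (y : Fin n → ℝ) :
    fvec (n + 1) y = (Matrix.of fun i j => fvec (n + 1) (xs j) i) *ᵥ
      bary z (fun i => β i.succ * (d i - y i)) := by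
  ext k
  simp only [Matrix.mulVec, dotProduct, Matrix.of_apply]
  refine Fin.cases ?_ (fun k => ?_) k
  · simp only [fvec_zero, one_mul, sum_bary]
  · simp only [fvec_succ, Fin.sum_univ_castSucc, hxs, hxl, bary, Fin.snoc_castSucc,
      Fin.snoc_last, sub_mul, ite_mul, zero_mul, Finset.sum_sub_distrib, Finset.sum_ite_eq,
      Finset.mem_univ, if_true, ← Finset.mul_sum]
    have := hβ k
    field_simp
    ring

lemma infoM_eq_corrected (a b m : ℝ) {p l : ℕ} (β : Fin p → ℝ)
    (x : Fin l → Fin (p - 1) → ℝ) (w : Fin l → ℝ) :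
    infoM a b m β x w = (a / b) • corrected (b / m) (e1v p) (infoMPo β x w) := rfl

lemma infoMPo_eq_conj {p l : ℕ} {k : Type*} [Fintype k] (β : Fin p → ℝ)
    {x : Fin l → Fin (p - 1) → ℝ} (w : Fin l → ℝ) {G : Matrix (Fin p) k ℝ}
    {φ : Fin l → k → ℝ} (h : ∀ j, fvec p (x j) = G *ᵥ φ j) :
    infoMPo β x w = G * (∑ j, (w j * Real.exp (fvec p (x j) ⬝ᵥ β)) •
      Matrix.vecMulVec (φ j) (φ j)) * Gᵀ := by
  rw [infoMPo, Matrix.mul_sum, Matrix.sum_mul]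
  refine Finset.sum_congr rfl fun j _ => ?_
  rw [Matrix.mul_smul, Matrix.smul_mul, Matrix.mul_vecMulVec, Matrix.vecMulVec_mul,
    ← Matrix.mulVec_transpose, Matrix.transpose_transpose, ← h]

lemma infoMPo_eq_conj_diagonal {n : ℕ} (β : Fin (n + 1) → ℝ) (xs : Fin (n + 1) → Fin n → ℝ)
    (w : Fin (n + 1) → ℝ) :
    infoMPo (p := n + 1) β xs w = (Matrix.of fun i j => fvec (n + 1) (xs j) i) *
      Matrix.diagonal (fun j => w j * Real.exp (fvec (n + 1) (xs j) ⬝ᵥ β)) *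
      (Matrix.of fun i j => fvec (n + 1) (xs j) i)ᵀ := by
  ext i j
  simp only [infoMPo, Matrix.sum_apply, Matrix.smul_apply, Matrix.vecMulVec_apply, smul_eq_mul]
  rw [Matrix.mul_apply]
  refine Finset.sum_congr rfl fun k _ => ?_
  simp only [Matrix.mul_diagonal, Matrix.transpose_apply, Matrix.of_apply]
  ring

/-- The design supported at `d - (z / β i) e_i` and `d` is optimal among all designs supported
in the orthant where the slacks `β i * (d i - y i)` are nonnegative. -/
lemma det_infoM_le {a b m : ℝ} (ha : 0 < a) (hb : 0 < b) (hm : 0 < m) {n : ℕ} (hn : 1 ≤ n)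
    {β : Fin (n + 1) → ℝ} (hβ : ∀ i : Fin n, β i.succ ≠ 0) {d : Fin n → ℝ} {z wp w1 : ℝ}
    (hz : 0 < z)
    (hwp : wp = 2 / ((n : ℝ) + 1 + Real.sqrt (((n : ℝ) - 1) ^ 2 + 4 * n *
      ((1 + (m / b) * Real.exp (fvec (n + 1) d ⬝ᵥ β)) /
        (1 + (m / b) * Real.exp (fvec (n + 1) d ⬝ᵥ β - z))))))
    (hw1 : w1 = (1 - wp) / n)
    (hzeq : 0 = m * (n * w1 * Real.exp (fvec (n + 1) d ⬝ᵥ β - z) +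
        wp * Real.exp (fvec (n + 1) d ⬝ᵥ β)) * (z * n * w1 - 2)
      + b * (z * ((n : ℝ) + 1) * w1 - 2))
    {xs : Fin (n + 1) → Fin n → ℝ}
    (hxs : ∀ i : Fin n, xs i.castSucc = fun k => d k - if k = i then z / β i.succ else 0)
    (hxl : xs (Fin.last n) = d)
    {ws : Fin (n + 1) → ℝ} (hws : ∀ i : Fin n, ws i.castSucc = w1) (hwl : ws (Fin.last n) = wp)
    {l : ℕ} {y : Fin l → Fin n → ℝ} {q : Fin l → ℝ} (hq : ∀ j, 0 ≤ q j) (hq1 : ∑ j, q j = 1)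
    (hy : ∀ j i, 0 ≤ β i.succ * (d i - y j i)) :
    (infoM a b m (p := n + 1) β y q).det ≤ (infoM a b m (p := n + 1) β xs ws).det := by
  set E := Real.exp (fvec (n + 1) d ⬝ᵥ β) with hEdef
  have hE : 0 < E := Real.exp_pos _
  have hEz : Real.exp (fvec (n + 1) d ⬝ᵥ β - z) = E * Real.exp (-z) := by
    rw [sub_eq_add_neg, Real.exp_add]
  rw [hEz] at hwp hzeq
  have hlam : ∀ x : Fin n → ℝ, Real.exp (fvec (n + 1) x ⬝ᵥ β)
      = E * Real.exp (-∑ i, β i.succ * (d i - x i)) := by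
    intro x
    rw [hEdef, ← Real.exp_add, fvec_dotProduct, fvec_dotProduct, ← Finset.sum_neg_distrib,
      add_assoc, ← Finset.sum_add_distrib]
    congr 2
    exact Finset.sum_congr rfl fun i _ => by ring
  have hτ : 0 < b / m := by positivity
  set τ := b / m with hτdef
  have hn' : (1 : ℝ) ≤ n := by exact_mod_cast hn
  have hez1 : Real.exp (-z) < 1 := by simpa using hz
  obtain ⟨hwp0, hw10, hbal⟩ := weight_balance (A := τ + E) (B := τ + E * Real.exp (-z)) hn'
    (by positivity) (by nlinarith) (by
      rw [hwp]
      congr 5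
      rw [hτdef]
      field_simp) hw1
  have hsum : n * w1 + wp = 1 := by rw [hw1]; field_simp; ring
  set T := τ + E * (n * w1 * Real.exp (-z) + wp) with hT
  have hTpos : 0 < T := by positivity
  have hT' : n * w1 * (τ + E * Real.exp (-z)) + wp * (τ + E) = T := by
    rw [hT]; linear_combination τ * hsum
  rw [hT'] at hbal
  have hopt : 2 * T = z * w1 * (n * T + τ) := by
    have hmτ : m * τ = b := by rw [hτdef]; field_simp
    refine mul_left_cancel₀ hm.ne' ?_
    rw [hT]
    linear_combination hzeq - (z * w1 * n + z * w1 - 2) * hmτ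
  set G : Matrix (Fin (n + 1)) (Fin (n + 1)) ℝ := Matrix.of fun i j => fvec (n + 1) (xs j) i
    with hG
  have hGe : Gᵀ *ᵥ e1v (n + 1) = 1 := by
    ext j
    simp [Matrix.mulVec, dotProduct, e1v, hG, fvec_zero]
  set D : Fin (n + 1) → ℝ := fun j => ws j * Real.exp (fvec (n + 1) (xs j) ⬝ᵥ β) with hDdef
  have hDc : ∀ i : Fin n, D i.castSucc = w1 * (E * Real.exp (-z)) := by
    intro i
    have := hβ i
    simp only [hDdef, hws, hxs, hlam, sub_sub_cancel, mul_ite, mul_zero, Finset.sum_ite_eq',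
      Finset.mem_univ, if_true]
    field_simp
  have hDl : D (Fin.last n) = wp * E := by
    simp [hDdef, hwl, hxl, hEdef]
  have hD : ∀ j, 0 < D j := by
    refine Fin.lastCases ?_ (fun i => ?_)
    · rw [hDl]; positivity
    · rw [hDc]; positivity
  have hDsum : τ + ∑ j, D j = T := by
    rw [Fin.sum_univ_castSucc, hDl]
    simp only [hDc, Finset.sum_const, Finset.card_univ, Fintype.card_fin, nsmul_eq_mul]
    rw [hT]; ring
  set s : Fin l → Fin n → ℝ := fun j i => β i.succ * (d i - y j i) with hsdef
  set κ : Fin l → ℝ := fun j => q j * Real.exp (fvec (n + 1) (y j) ⬝ᵥ β) with hκ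
  have hκ0 : ∀ j, 0 ≤ κ j := fun j => mul_nonneg (hq j) (Real.exp_pos _).le
  set M : Matrix (Fin (n + 1)) (Fin (n + 1)) ℝ :=
    ∑ j, κ j • Matrix.vecMulVec (bary z (s j)) (bary z (s j)) with hM
  have hMpsd : M.PosSemidef := by
    refine Matrix.posSemidef_sum _ fun j _ => Matrix.PosSemidef.smul ?_ (hκ0 j)
    simpa using Matrix.posSemidef_vecMulVec_self_star (bary z (s j))
  have hMsum : ∑ i, ∑ k, M i k = ∑ j, κ j := by
    have : (1 : Fin (n + 1) → ℝ) ⬝ᵥ (M *ᵥ 1) = ∑ j, κ j := by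
      rw [hM, Matrix.sum_mulVec, dotProduct_sum]
      refine Finset.sum_congr rfl fun j _ => ?_
      have h1 : bary z (s j) ⬝ᵥ 1 = 1 := by simp [dotProduct, sum_bary]
      rw [Matrix.smul_mulVec, Matrix.vecMulVec_mulVec, h1]
      simp [dotProduct_comm 1, h1]
    rw [← this]
    simp [dotProduct, Matrix.mulVec]
  have hpoint : ∀ j, κ j * ∑ i, bary z (s j) i ^ 2 / D i
      ≤ q j * (n + τ / T) + κ j / T := by
    intro j
    have h1 := sensitivity_le hτ hE hz hwp0 hw10 hsum hT hbal hopt (hy j)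
    have h2 := mul_le_mul_of_nonneg_left h1 (hq j)
    have h3 : ∑ i, bary z (s j) i ^ 2 / D i =
        ∑ i, (s j i / z) ^ 2 / (w1 * (E * Real.exp (-z)))
        + (1 - ∑ i, s j i / z) ^ 2 / (wp * E) := by
      simp only [Fin.sum_univ_castSucc, hDc, hDl, bary, Fin.snoc_castSucc, Fin.snoc_last]
    rw [h3, hκ]
    simp only [hlam]
    calc _ = _ := by ring
      _ ≤ _ := h2
      _ = _ := by ring
  have htr : ∑ i, M i i / D i ≤ Fintype.card (Fin (n + 1)) - 1
      + (τ + ∑ i, ∑ k, M i k) / (τ + ∑ i, D i) := by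
    rw [hMsum, hDsum, Fintype.card_fin]
    have h1 : ∑ i, M i i / D i = ∑ j, κ j * ∑ i, bary z (s j) i ^ 2 / D i := by
      simp only [hM, Matrix.sum_apply, Matrix.smul_apply, Matrix.vecMulVec_apply, smul_eq_mul,
        Finset.sum_div, Finset.mul_sum]
      rw [Finset.sum_comm]
      exact Finset.sum_congr rfl fun j _ => Finset.sum_congr rfl fun i _ => by ring
    calc _ = _ := h1
      _ ≤ ∑ j, (q j * (n + τ / T) + κ j / T) := Finset.sum_le_sum fun j _ => hpoint j
      _ = _ := by
        rw [Finset.sum_add_distrib, ← Finset.sum_mul, hq1, ← Finset.sum_div]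
        push_cast
        ring
  have hkey := det_corrected_le_of_trace_le hMpsd hD hτ htr
  have e1 : infoMPo (p := n + 1) β y q = G * M * Gᵀ :=
    infoMPo_eq_conj (p := n + 1) β q fun j => fvec_eq_sum_bary hz hβ hxs hxl (y j)
  have e2 : infoMPo (p := n + 1) β xs ws = G * Matrix.diagonal D * Gᵀ :=
    infoMPo_eq_conj_diagonal β xs ws
  rw [infoM_eq_corrected, infoM_eq_corrected, e1, e2, corrected_conj, corrected_conj, hGe,
    Matrix.det_smul, Matrix.det_smul]
  refine mul_le_mul_of_nonneg_left ?_ (by positivity)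
  simp only [Matrix.det_mul, Matrix.det_transpose]
  nlinarith [mul_le_mul_of_nonneg_left hkey (sq_nonneg G.det)]

/-- The D-optimal design for the Poisson-Gamma model with multiple regression on the
rectangular design region `X = [u₁,v₁] × … × [u_{p−1},v_{p−1}]`: the design `ξ*` with
support points `d − (z*/β_i)·e_i` (weights `w₁*(z*)`) and `d` (weight `w_p*(z*)`)
maximizes `det M(ξ;β)` over all designs on `X`. -/
theorem D_optimal_design_poisson_gamma
    (a b m : ℝ) (ha : 0 < a) (hb : 0 < b) (hm : 0 < m)
    (p : ℕ) (hp : 2 ≤ p)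
    (u v : Fin (p - 1) → ℝ) (huv : ∀ i, u i < v i)
    (β : Fin p → ℝ)
    (ι : Fin (p - 1) → Fin p) (hι : ∀ i, (ι i : ℕ) = (i : ℕ) + 1)
    (hβ : ∀ i, β (ι i) ≠ 0)
    (d : Fin (p - 1) → ℝ)
    (hd : ∀ i, (0 < β (ι i) → d i = v i) ∧ (β (ι i) < 0 → d i = u i))
    (wpf w1f : ℝ → ℝ)
    (hwpf : ∀ z, wpf z = 2 / ((p : ℝ) + Real.sqrt (((p : ℝ) - 2) ^ 2 +
      4 * ((p : ℝ) - 1) * ((1 + (m / b) * Real.exp (fvec p d ⬝ᵥ β)) /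
        (1 + (m / b) * Real.exp (fvec p d ⬝ᵥ β - z))))))
    (hw1f : ∀ z, w1f z = (1 - wpf z) / ((p : ℝ) - 1))
    (zs : ℝ) (hzs : 0 < zs)
    (hzeq : 0 = m * (((p : ℝ) - 1) * w1f zs * Real.exp (fvec p d ⬝ᵥ β - zs) +
        wpf zs * Real.exp (fvec p d ⬝ᵥ β)) * (zs * ((p : ℝ) - 1) * w1f zs - 2)
      + b * (zs * (p : ℝ) * w1f zs - 2))
    (hzmin : ∀ i, zs ≤ |β (ι i)| * (v i - u i))
    (xs : Fin p → Fin (p - 1) → ℝ)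
    (hxs : ∀ j : Fin p, xs j = if h : (j : ℕ) < p - 1
      then (fun k => d k - if k = (⟨(j : ℕ), h⟩ : Fin (p - 1))
        then zs / β (ι ⟨(j : ℕ), h⟩) else 0)
      else d)
    (ws : Fin p → ℝ)
    (hws : ∀ j : Fin p, ws j = if (j : ℕ) < p - 1 then w1f zs else wpf zs) :
    ∀ (l : ℕ) (y : Fin l → Fin (p - 1) → ℝ) (q : Fin l → ℝ),
      (∀ j, 0 ≤ q j) → (∑ j, q j) = 1 →
      (∀ j i, u i ≤ y j i ∧ y j i ≤ v i) →
      (infoM a b m β y q).det ≤ (infoM a b m β xs ws).det := by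
  intro l y q hq hq1 hy
  obtain ⟨n, rfl⟩ : ∃ n, p = n + 1 := ⟨p - 1, by omega⟩
  have hιs : ∀ i : Fin n, ι i = i.succ := fun i => Fin.ext (hι i)
  have hcast : ((n + 1 : ℕ) : ℝ) - 1 = n := by push_cast; ring
  have hcast2 : ((n + 1 : ℕ) : ℝ) - 2 = n - 1 := by push_cast; ring
  have hcast3 : ((n + 1 : ℕ) : ℝ) = n + 1 := by push_cast; ring
  have hwp := hwpf zs
  have hw1 := hw1f zs
  rw [hcast, hcast2, hcast3] at hwp
  rw [hcast] at hw1
  rw [hcast, hcast3] at hzeq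
  refine det_infoM_le ha hb hm (n := n) (by omega) (d := d) (z := zs)
    (fun i => by rw [← hιs]; exact hβ i) hzs hwp hw1 hzeq (fun i => ?_) ?_ (fun i => ?_) ?_
    hq hq1 (fun j i => ?_)
  · have hi : ((i.castSucc : Fin (n + 1)) : ℕ) < n + 1 - 1 := by simp
    rw [hxs, dif_pos hi, ← hιs]
    rfl
  · rw [hxs, dif_neg (by simp)]
  · rw [hws, if_pos (by simp)]
  · rw [hws, if_neg (by simp)]
  · rw [← hιs]
    obtain ⟨hlo, hhi⟩ := hy j i
    rcases lt_or_gt_of_ne (hβ i) with h | h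
    · rw [(hd i).2 h]
      exact mul_nonneg_of_nonpos_of_nonpos h.le (by linarith)
    · rw [(hd i).1 h]
      exact mul_nonneg h.le (by linarith)
end
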